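/- Let Δ_D be the Dirichlet Laplacian on ℓ²(ℕ) with hopping constant t_c > 0, and for n, m ∈ ℕ, E ∈ ℝ and ε > 0 let G_ε(E; n, m) := ⟨δ_n, (Δ_D − (E + iε))^{-1} δ_m⟩ (well defined since Δ_D is bounded self-adjoint). Then: (i) for every θ ∈ (0, π), lim_{ε→0⁺} G_ε(2t_c cos θ; n, m) = (e^{−iθ(n+m+2)} − e^{−iθ|n−m|}) / (2i t_c sin θ); (ii) lim_{ε→0⁺} G_ε(2t_c; n, m) = (|n−m| − (n+m+2)) / (2t_c); (iii) lim_{ε→0⁺} G_ε(−2t_c; n, m) = (−1)^{n+m} (n+m+2 − |n−m|) / (2t_c). Moreover, for every E ∈ ℝ the limit G(E; n, m) := lim_{ε→0⁺} G_ε(E; n, m) exists, the function E ↦ G(E; n, m) is continuous on ℝ, and it is real-valued for |E| > 2t_c. -/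

import Mathlib

open scoped InnerProductSpace
open Filter Topology Complex

noncomputable section

/-- `ℓ²(ℕ)` -/
abbrev Lead := lp (fun _ : ℕ => ℂ) 2

/-- standard basis vector `δ_n` -/
def kn (n : ℕ) : Lead := lp.single 2 n 1

/-- matrix elements of the Dirichlet Laplacian on `ℓ²(ℕ)` with hopping constant `tc` -/
def dirEntry (tc : ℝ) (n m : ℕ) : ℂ := if n = m + 1 ∨ m = n + 1 then (tc : ℂ) else 0

/-- the Green function `G_ε(E; n, m) = ⟨δ_n, (Δ_D - (E+iε))⁻¹ δ_m⟩` -/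
def green (Δ : Lead →L[ℂ] Lead) (E ε : ℝ) (n m : ℕ) : ℂ :=
  ⟪kn n, (Ring.inverse (Δ - ((E : ℂ) + ε * Complex.I) • (1 : Lead →L[ℂ] Lead))) (kn m)⟫_ℂ

/-- The square root with values in the closed first quadrant, for arguments in the closed upper
half-plane; it is continuous on the whole plane. -/
def quadrantSqrt (z : ℂ) : ℂ := ⟨√((‖z‖ + z.re) / 2), √((‖z‖ - z.re) / 2)⟩

lemma continuous_quadrantSqrt : Continuous quadrantSqrt := by
  have : quadrantSqrt = fun z : ℂ =>
      ((√((‖z‖ + z.re) / 2) : ℝ) : ℂ) + ((√((‖z‖ - z.re) / 2) : ℝ) : ℂ) * I := by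
    funext z
    apply Complex.ext <;> simp [quadrantSqrt]
  rw [this]
  fun_prop

lemma quadrantSqrt_sq {z : ℂ} (hz : 0 ≤ z.im) : quadrantSqrt z ^ 2 = z := by
  have h := abs_le.mp (Complex.abs_re_le_norm z)
  have h1 : 0 ≤ (‖z‖ + z.re) / 2 := by linarith
  have h2 : 0 ≤ (‖z‖ - z.re) / 2 := by linarith
  have h3 : √((‖z‖ + z.re) / 2) * √((‖z‖ - z.re) / 2) = z.im / 2 := by
    rw [← Real.sqrt_mul h1]
    have : (‖z‖ + z.re) / 2 * ((‖z‖ - z.re) / 2) = (z.im / 2) ^ 2 := by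
      have := Complex.sq_norm z
      rw [Complex.normSq_apply] at this
      linear_combination this / 4
    rw [this, Real.sqrt_sq (by linarith)]
  apply Complex.ext
  · simp only [sq, quadrantSqrt, Complex.mul_re, Real.mul_self_sqrt h1, Real.mul_self_sqrt h2]
    ring
  · simp only [sq, quadrantSqrt, Complex.mul_im]
    linear_combination 2 * h3

lemma quadrantSqrt_re_pos {z : ℂ} (hz : 0 < z.im) : 0 < (quadrantSqrt z).re := by
  have h := abs_lt.mp (Complex.abs_re_lt_norm.mpr hz.ne')
  exact Real.sqrt_pos.mpr (by linarith)

lemma quadrantSqrt_im_nonneg (z : ℂ) : 0 ≤ (quadrantSqrt z).im := Real.sqrt_nonneg _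

lemma quadrantSqrt_ofReal_of_nonneg {x : ℝ} (hx : 0 ≤ x) : quadrantSqrt x = (√x : ℝ) := by
  apply Complex.ext <;> simp [quadrantSqrt, abs_of_nonneg hx]

lemma quadrantSqrt_ofReal_of_nonpos {x : ℝ} (hx : x ≤ 0) :
    quadrantSqrt x = (√(-x) : ℝ) * I := by
  apply Complex.ext
  · simp [quadrantSqrt, abs_of_nonpos hx]
  · simp only [quadrantSqrt, Complex.norm_real, Real.norm_eq_abs, abs_of_nonpos hx,
      Complex.ofReal_re, Complex.im_ofReal_mul, Complex.I_im, mul_one]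
    congr 1
    ring

/-- The inverse of the Joukowsky map `w ↦ (w + w⁻¹) / 2` from the upper half-plane into the unit
disc, extended continuously. -/
def joukowskyInv (ζ : ℂ) : ℂ := (quadrantSqrt (ζ - 1) - quadrantSqrt (ζ + 1)) ^ 2 / 2

lemma continuous_joukowskyInv : Continuous joukowskyInv := by
  have h := continuous_quadrantSqrt
  unfold joukowskyInv
  fun_prop

lemma joukowskyInv_sq_add_one {ζ : ℂ} (hζ : 0 ≤ ζ.im) :
    joukowskyInv ζ ^ 2 + 1 = 2 * ζ * joukowskyInv ζ := by
  have h1 : quadrantSqrt (ζ - 1) ^ 2 = ζ - 1 := quadrantSqrt_sq (by simpa using hζ)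
  have h2 : quadrantSqrt (ζ + 1) ^ 2 = ζ + 1 := quadrantSqrt_sq (by simpa using hζ)
  unfold joukowskyInv
  set a := quadrantSqrt (ζ - 1)
  set b := quadrantSqrt (ζ + 1)
  have hζ' : ζ = (a ^ 2 + b ^ 2) / 2 := by rw [h1, h2]; ring
  have h3 : (b ^ 2 - a ^ 2) ^ 2 = 4 := by rw [h1, h2]; ring
  rw [hζ']
  linear_combination -h3 / 4

lemma norm_joukowskyInv_lt_one {ζ : ℂ} (hζ : 0 < ζ.im) : ‖joukowskyInv ζ‖ < 1 := by
  have h1 : quadrantSqrt (ζ - 1) ^ 2 = ζ - 1 := quadrantSqrt_sq (by simpa using hζ.le)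
  have h2 : quadrantSqrt (ζ + 1) ^ 2 = ζ + 1 := quadrantSqrt_sq (by simpa using hζ.le)
  have ha : 0 < (quadrantSqrt (ζ - 1)).re := quadrantSqrt_re_pos (by simpa using hζ)
  have hb : 0 < (quadrantSqrt (ζ + 1)).re := quadrantSqrt_re_pos (by simpa using hζ)
  have ha' := quadrantSqrt_im_nonneg (ζ - 1)
  have hb' := quadrantSqrt_im_nonneg (ζ + 1)
  unfold joukowskyInv
  set a := quadrantSqrt (ζ - 1)
  set b := quadrantSqrt (ζ + 1)
  have h3 : ‖a - b‖ * ‖a + b‖ = 2 := by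
    rw [← norm_mul, show (a - b) * (a + b) = -2 by linear_combination h1 - h2]
    simp
  have h4 : ‖a - b‖ < ‖a + b‖ := by
    rw [← sq_lt_sq₀ (norm_nonneg _) (norm_nonneg _), Complex.sq_norm, Complex.sq_norm,
      Complex.normSq_apply, Complex.normSq_apply]
    simp only [Complex.sub_re, Complex.sub_im, Complex.add_re, Complex.add_im]
    nlinarith [mul_pos ha hb, mul_nonneg ha' hb']
  have h5 : 0 < ‖a - b‖ := by
    rcases (norm_nonneg (a - b)).eq_or_lt with h | h
    · rw [← h] at h3; norm_num at h3
    · exact h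
  rw [norm_div, norm_pow, Complex.norm_ofNat]
  nlinarith

lemma joukowskyInv_cos {θ : ℝ} (h0 : 0 ≤ θ) (hπ : θ ≤ Real.pi) :
    joukowskyInv (Real.cos θ : ℝ) = Complex.exp (-I * θ) := by
  have hc := Real.cos_le_one θ
  have hc' := Real.neg_one_le_cos θ
  have h1 : quadrantSqrt ((Real.cos θ : ℝ) - 1) = (√(1 - Real.cos θ) : ℝ) * I := by
    have := quadrantSqrt_ofReal_of_nonpos (x := Real.cos θ - 1) (by linarith)
    rw [neg_sub] at this
    rw [← this]
    push_cast; rfl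
  have h2 : quadrantSqrt ((Real.cos θ : ℝ) + 1) = (√(Real.cos θ + 1) : ℝ) := by
    rw [← quadrantSqrt_ofReal_of_nonneg (by linarith)]
    push_cast; rfl
  have h3 : √(1 - Real.cos θ) * √(Real.cos θ + 1) = Real.sin θ := by
    rw [← Real.sqrt_mul (by linarith), ← Real.sqrt_sq (Real.sin_nonneg_of_nonneg_of_le_pi h0 hπ)]
    congr 1
    linear_combination -Real.sin_sq_add_cos_sq θ
  have h4 := Real.sq_sqrt (show 0 ≤ 1 - Real.cos θ by linarith)
  have h5 := Real.sq_sqrt (show 0 ≤ Real.cos θ + 1 by linarith)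
  have h6 : Complex.exp (-I * θ) = (Real.cos θ : ℝ) - (Real.sin θ : ℝ) * I := by
    rw [show -I * θ = ((-θ : ℝ) : ℂ) * I by push_cast; ring, Complex.exp_mul_I,
      ← Complex.ofReal_cos, ← Complex.ofReal_sin, Real.cos_neg, Real.sin_neg]
    push_cast; ring
  rw [joukowskyInv, h1, h2, h6, ← h3]
  have h4' : ((√(1 - Real.cos θ) : ℝ) : ℂ) ^ 2 = 1 - (Real.cos θ : ℝ) := by exact_mod_cast h4
  have h5' : ((√(Real.cos θ + 1) : ℝ) : ℂ) ^ 2 = (Real.cos θ : ℝ) + 1 := by exact_mod_cast h5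
  rw [Complex.ofReal_mul]
  linear_combination (-h4' + h5') / 2 + ((√(1 - Real.cos θ) : ℝ) : ℂ) ^ 2 / 2 * I_sq

lemma joukowskyInv_one : joukowskyInv ((1 : ℝ) : ℂ) = 1 := by
  simpa using joukowskyInv_cos le_rfl Real.pi_pos.le

lemma joukowskyInv_neg_one : joukowskyInv ((-1 : ℝ) : ℂ) = -1 := by
  rw [← Real.cos_pi, joukowskyInv_cos Real.pi_pos.le le_rfl, neg_mul, Complex.exp_neg, mul_comm,
    Complex.exp_pi_mul_I]
  norm_num

lemma joukowskyInv_ofReal_im {x : ℝ} (hx : 1 ≤ |x|) : (joukowskyInv x).im = 0 := by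
  have e1 : (x : ℂ) - 1 = ((x - 1 : ℝ) : ℂ) := by push_cast; rfl
  have e2 : (x : ℂ) + 1 = ((x + 1 : ℝ) : ℂ) := by push_cast; rfl
  rw [joukowskyInv, e1, e2]
  rcases le_abs.mp hx with h | h
  · rw [quadrantSqrt_ofReal_of_nonneg (by linarith), quadrantSqrt_ofReal_of_nonneg (by linarith)]
    norm_cast
  · rw [quadrantSqrt_ofReal_of_nonpos (by linarith), quadrantSqrt_ofReal_of_nonpos (by linarith),
      ← sub_mul, mul_pow, I_sq]
    norm_cast

/-- Up to the factor `-tc⁻¹`, the Green function in terms of the inverse Joukowsky variable. -/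
def greenPoly (n m : ℕ) (w : ℂ) : ℂ :=
  ∑ k ∈ Finset.range (min n m + 1), w ^ ((n - m) + (m - n) + 1 + 2 * k)

lemma continuous_greenPoly (n m : ℕ) : Continuous (greenPoly n m) := by
  unfold greenPoly
  fun_prop

lemma one_sub_sq_mul_greenPoly (n m : ℕ) (w : ℂ) :
    (1 - w ^ 2) * greenPoly n m w = w * (w ^ ((n - m) + (m - n)) - w ^ (n + m + 2)) := by
  have h : greenPoly n m w =
      w ^ ((n - m) + (m - n) + 1) * ∑ k ∈ Finset.range (min n m + 1), (w ^ 2) ^ k := by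
    rw [greenPoly, Finset.mul_sum]
    refine Finset.sum_congr rfl fun k _ => ?_
    rw [← pow_mul, ← pow_add]
  have h2 : n + m + 2 = (n - m) + (m - n) + 2 * (min n m + 1) := by omega
  rw [h, h2, mul_left_comm, mul_neg_geom_sum, pow_add w _ (2 * _), ← pow_mul]
  ring

lemma one_sub_sq_ne_zero {w : ℂ} (hw : ‖w‖ < 1) : 1 - w ^ 2 ≠ 0 := by
  intro h
  have h1 : ‖w‖ ^ 2 = 1 := by rw [← norm_pow, ← sub_eq_zero.mp h, norm_one]
  nlinarith [norm_nonneg w]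

lemma greenPoly_one (n m : ℕ) : greenPoly n m 1 = (min n m : ℕ) + 1 := by
  simp [greenPoly, -Nat.cast_min]

lemma greenPoly_neg_one (n m : ℕ) :
    greenPoly n m (-1) = -((-1) ^ (n + m) * ((min n m : ℕ) + 1)) := by
  have h : ∀ k, (-1 : ℂ) ^ ((n - m) + (m - n) + 1 + 2 * k) = -(-1) ^ (n + m) := by
    intro k
    rw [show n + m = (n - m) + (m - n) + 2 * min n m by omega]
    simp [pow_add, pow_mul]
  simp only [greenPoly, h, Finset.sum_const, Finset.card_range, nsmul_eq_mul]
  generalize min n m = k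
  push_cast
  ring

lemma abs_sub_natCast (n m : ℕ) : |(n : ℝ) - m| = (((n - m) + (m - n) : ℕ) : ℝ) := by
  rcases le_total n m with h | h
  · rw [abs_of_nonpos (by simpa using h), Nat.sub_eq_zero_of_le h]
    push_cast [Nat.cast_sub h]; ring
  · rw [abs_of_nonneg (by simpa using h), Nat.sub_eq_zero_of_le h]
    push_cast [Nat.cast_sub h]; ring

lemma two_mul_min_add_one (n m : ℕ) :
    2 * ((min n m : ℕ) + 1 : ℝ) = (n : ℝ) + m + 2 - |(n : ℝ) - m| := by
  rw [abs_sub_natCast]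
  have : 2 * (min n m + 1) + ((n - m) + (m - n)) = n + m + 2 := by omega
  have := congrArg (Nat.cast : ℕ → ℝ) this
  push_cast at this ⊢
  linarith

/-- The three-term recurrence for `greenPoly` away from the left end. -/
lemma greenPoly_recurrence {w : ℂ} (hw : ‖w‖ < 1) (n m : ℕ) :
    w * (greenPoly (n + 2) m w + greenPoly n m w) - (w ^ 2 + 1) * greenPoly (n + 1) m w
      = -(w * if n + 1 = m then 1 else 0) := by
  apply mul_left_cancel₀ (one_sub_sq_ne_zero hw)
  have e0 := one_sub_sq_mul_greenPoly n m w
  have e1 := one_sub_sq_mul_greenPoly (n + 1) m w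
  have e2 := one_sub_sq_mul_greenPoly (n + 2) m w
  rcases lt_trichotomy (n + 1) m with h | h | h
  · obtain ⟨k, rfl⟩ := Nat.exists_eq_add_of_lt h
    rw [show n - (n + 1 + k + 1) + (n + 1 + k + 1 - n) = k + 2 by omega] at e0
    rw [show n + 1 - (n + 1 + k + 1) + (n + 1 + k + 1 - (n + 1)) = k + 1 by omega] at e1
    rw [show n + 2 - (n + 1 + k + 1) + (n + 1 + k + 1 - (n + 2)) = k by omega] at e2
    rw [if_neg h.ne]
    linear_combination w * (e0 + e2) - (w ^ 2 + 1) * e1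
  · subst h
    rw [show n - (n + 1) + (n + 1 - n) = 1 by omega] at e0
    rw [show n + 1 - (n + 1) + (n + 1 - (n + 1)) = 0 by omega] at e1
    rw [show n + 2 - (n + 1) + (n + 1 - (n + 2)) = 1 by omega] at e2
    rw [if_pos rfl]
    linear_combination w * (e0 + e2) - (w ^ 2 + 1) * e1
  · obtain ⟨k, rfl⟩ := Nat.exists_eq_add_of_le (Nat.lt_succ_iff.mp h)
    rw [show m + k - m + (m - (m + k)) = k by omega] at e0
    rw [show m + k + 1 - m + (m - (m + k + 1)) = k + 1 by omega] at e1
    rw [show m + k + 2 - m + (m - (m + k + 2)) = k + 2 by omega] at e2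
    rw [if_neg h.ne']
    linear_combination w * (e0 + e2) - (w ^ 2 + 1) * e1

/-- The recurrence for `greenPoly` at the left end, where the Dirichlet condition enters. -/
lemma greenPoly_recurrence_zero {w : ℂ} (hw : ‖w‖ < 1) (m : ℕ) :
    w * greenPoly 1 m w - (w ^ 2 + 1) * greenPoly 0 m w = -(w * if 0 = m then 1 else 0) := by
  apply mul_left_cancel₀ (one_sub_sq_ne_zero hw)
  have e0 := one_sub_sq_mul_greenPoly 0 m w
  have e1 := one_sub_sq_mul_greenPoly 1 m w
  rcases m with _ | m
  · simp only [if_true]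
    linear_combination w * e1 - (w ^ 2 + 1) * e0
  · rw [show 0 - (m + 1) + (m + 1 - 0) = m + 1 by omega] at e0
    rw [show 1 - (m + 1) + (m + 1 - 1) = m by omega] at e1
    rw [if_neg (by omega)]
    linear_combination w * e1 - (w ^ 2 + 1) * e0

lemma memℓp_greenPoly (m : ℕ) {w : ℂ} (hw : ‖w‖ < 1) :
    Memℓp (fun n => greenPoly n m w) 2 := by
  refine memℓp_gen ?_
  rw [← summable_nat_add_iff m]
  have h : ∀ n, greenPoly (n + m) m w = w ^ n * greenPoly m m w := by
    intro n
    rw [greenPoly, greenPoly, Finset.mul_sum]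
    refine Finset.sum_congr (by simp) fun k _ => ?_
    rw [← pow_add]
    congr 1
    omega
  simp only [h, norm_mul, norm_pow, ENNReal.toReal_ofNat, Real.rpow_two, mul_pow]
  refine Summable.mul_right _ ?_
  simp only [← pow_mul, mul_comm _ 2]
  simp only [pow_mul]
  exact summable_geometric_of_lt_one (by positivity) (by nlinarith [norm_nonneg w])

lemma inner_kn (n : ℕ) (f : Lead) : ⟪kn n, f⟫_ℂ = f n := by
  rw [kn, lp.inner_single_left]
  simp

lemma kn_apply (m n : ℕ) : (kn m : ℕ → ℂ) n = if n = m then 1 else 0 := by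
  rw [kn, lp.single_apply]
  split_ifs with h <;> simp [h]

section Resolvent

variable {tc : ℝ} {Δ : Lead →L[ℂ] Lead}

lemma apply_kn_zero (hΔ : ∀ n m : ℕ, ⟪kn n, Δ (kn m)⟫_ℂ = dirEntry tc n m) :
    Δ (kn 0) = (tc : ℂ) • kn 1 := by
  ext k
  rw [← inner_kn, hΔ, lp.coeFn_smul, Pi.smul_apply, kn_apply, dirEntry]
  simp

lemma apply_kn_succ (hΔ : ∀ n m : ℕ, ⟪kn n, Δ (kn m)⟫_ℂ = dirEntry tc n m) (n : ℕ) :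
    Δ (kn (n + 1)) = (tc : ℂ) • (kn (n + 2) + kn n) := by
  ext k
  rw [← inner_kn, hΔ, lp.coeFn_smul, Pi.smul_apply, lp.coeFn_add, Pi.add_apply, kn_apply,
    kn_apply, dirEntry]
  by_cases h1 : k = n + 2
  · simp [h1]
  · by_cases h2 : k = n
    · simp [h2]
    · rw [if_neg (by omega), if_neg h1, if_neg h2]
      simp

lemma apply_zero (hsa : IsSelfAdjoint Δ)
    (hΔ : ∀ n m : ℕ, ⟪kn n, Δ (kn m)⟫_ℂ = dirEntry tc n m) (f : Lead) :
    Δ f 0 = tc * f 1 := by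
  rw [← inner_kn, ← ContinuousLinearMap.adjoint_inner_left, hsa.adjoint_eq, apply_kn_zero hΔ,
    inner_smul_left, inner_kn]
  simp

lemma apply_succ (hsa : IsSelfAdjoint Δ)
    (hΔ : ∀ n m : ℕ, ⟪kn n, Δ (kn m)⟫_ℂ = dirEntry tc n m) (f : Lead) (n : ℕ) :
    Δ f (n + 1) = tc * (f (n + 2) + f n) := by
  rw [← inner_kn, ← ContinuousLinearMap.adjoint_inner_left, hsa.adjoint_eq, apply_kn_succ hΔ,
    inner_smul_left, inner_add_left, inner_kn, inner_kn]
  simp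

/-- The action of `Δ - z` on the explicit solution, for `z = tc (w + w⁻¹)`. -/
lemma sub_smul_apply_greenPoly (hsa : IsSelfAdjoint Δ)
    (hΔ : ∀ n m : ℕ, ⟪kn n, Δ (kn m)⟫_ℂ = dirEntry tc n m) {w z : ℂ} (hw : ‖w‖ < 1)
    (hz : tc * (w ^ 2 + 1) = z * w) (hw0 : w ≠ 0) (m : ℕ) :
    (Δ - z • (1 : Lead →L[ℂ] Lead)) ⟨fun n => greenPoly n m w, memℓp_greenPoly m hw⟩ =
      -(tc : ℂ) • kn m := by
  set u : Lead := ⟨fun n => greenPoly n m w, memℓp_greenPoly m hw⟩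
  have hu : ∀ n, u n = greenPoly n m w := fun _ => rfl
  ext n
  have hl : ((Δ - z • (1 : Lead →L[ℂ] Lead)) u) n = Δ u n - z * u n := rfl
  have hr : (-(tc : ℂ) • kn m : Lead) n = -(tc : ℂ) * if n = m then 1 else 0 := by
    rw [lp.coeFn_smul, Pi.smul_apply, kn_apply, smul_eq_mul]
  rw [hl, hr]
  apply mul_left_cancel₀ hw0
  rcases n with _ | n
  · rw [apply_zero hsa hΔ, hu, hu]
    linear_combination greenPoly 0 m w * hz + (tc : ℂ) * greenPoly_recurrence_zero hw m
  · rw [apply_succ hsa hΔ, hu, hu, hu]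
    linear_combination greenPoly (n + 1) m w * hz + (tc : ℂ) * greenPoly_recurrence hw n m

lemma isUnit_sub_smul_one (hsa : IsSelfAdjoint Δ) {z : ℂ} (hz : z.im ≠ 0) :
    IsUnit (Δ - z • (1 : Lead →L[ℂ] Lead)) := by
  by_contra h
  have hmem : z ∈ spectrum ℂ Δ := by
    rw [spectrum.mem_iff, Algebra.algebraMap_eq_smul_one, ← neg_sub, IsUnit.neg_iff]
    exact h
  have := hsa.mem_spectrum_eq_re hmem
  exact hz (by rw [this]; simp)

lemma green_eq (htc : 0 < tc) (hsa : IsSelfAdjoint Δ)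
    (hΔ : ∀ n m : ℕ, ⟪kn n, Δ (kn m)⟫_ℂ = dirEntry tc n m) (E : ℝ) {ε : ℝ} (hε : 0 < ε)
    (n m : ℕ) :
    green Δ E ε n m = -greenPoly n m (joukowskyInv ((E + ε * I) / (2 * tc))) / tc := by
  have htc' : (tc : ℂ) ≠ 0 := by exact_mod_cast htc.ne'
  set z : ℂ := E + ε * I with hzdef
  have hzim : z.im = ε := by simp [hzdef]
  have hζ : 0 < (z / (2 * tc)).im := by
    rw [show (2 * tc : ℂ) = ((2 * tc : ℝ) : ℂ) by push_cast; rfl, Complex.div_ofReal_im, hzim]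
    positivity
  set w := joukowskyInv (z / (2 * tc))
  have hw : ‖w‖ < 1 := norm_joukowskyInv_lt_one hζ
  have hJ : w ^ 2 + 1 = 2 * (z / (2 * tc)) * w := joukowskyInv_sq_add_one hζ.le
  have hw0 : w ≠ 0 := by
    intro h
    simp [h] at hJ
  have hz : tc * (w ^ 2 + 1) = z * w := by
    rw [hJ]
    field_simp
  have hu := sub_smul_apply_greenPoly hsa hΔ hw hz hw0 m
  have hunit : IsUnit (Δ - z • (1 : Lead →L[ℂ] Lead)) :=
    isUnit_sub_smul_one hsa (by rw [hzim]; exact hε.ne')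
  have hinv := congrArg (Ring.inverse (Δ - z • (1 : Lead →L[ℂ] Lead)) : Lead →L[ℂ] Lead) hu
  rw [← ContinuousLinearMap.comp_apply, ← ContinuousLinearMap.mul_def,
    Ring.inverse_mul_cancel _ hunit, one_apply_eq_self, map_smul] at hinv
  have hn := congrArg (fun f : Lead => f n) hinv
  simp only [lp.coeFn_smul, Pi.smul_apply, smul_eq_mul] at hn
  rw [green, inner_kn, eq_div_iff htc', hn]
  ring

lemma tendsto_green (htc : 0 < tc) (hsa : IsSelfAdjoint Δ)
    (hΔ : ∀ n m : ℕ, ⟪kn n, Δ (kn m)⟫_ℂ = dirEntry tc n m) (E : ℝ) (n m : ℕ) :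
    Tendsto (fun ε : ℝ => green Δ E ε n m) (𝓝[>] 0)
      (𝓝 (-greenPoly n m (joukowskyInv ((E / (2 * tc) : ℝ) : ℂ)) / tc)) := by
  have hc : Continuous fun ε : ℝ =>
      -greenPoly n m (joukowskyInv ((E + ε * I) / (2 * tc))) / tc := by
    have h1 := continuous_greenPoly n m
    have h2 := continuous_joukowskyInv
    fun_prop
  have h := (hc.tendsto 0).mono_left (nhdsWithin_le_nhds (s := Set.Ioi 0))
  have e : (((E / (2 * tc) : ℝ)) : ℂ) = (E + ((0 : ℝ) : ℂ) * I) / (2 * tc) := by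
    push_cast; simp
  rw [e]
  refine h.congr' ?_
  filter_upwards [self_mem_nhdsWithin] with ε hε
  exact (green_eq htc hsa hΔ E hε n m).symm

end Resolvent

/-- Lemma B.1: boundary values of the Green function of the Dirichlet Laplacian. -/
theorem stmt16 (tc : ℝ) (htc : 0 < tc) (Δ : Lead →L[ℂ] Lead)
    (hΔsa : IsSelfAdjoint Δ)
    (hΔ : ∀ n m : ℕ, ⟪kn n, Δ (kn m)⟫_ℂ = dirEntry tc n m) :
    (∀ n m : ℕ, ∀ θ ∈ Set.Ioo 0 Real.pi,
      Tendsto (fun ε : ℝ => green Δ (2*tc*Real.cos θ) ε n m) (𝓝[>] 0)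
        (𝓝 ((Complex.exp (-Complex.I*θ*((n:ℂ)+(m:ℂ)+2)) -
              Complex.exp (-Complex.I*θ*(|(n:ℝ)-(m:ℝ)| : ℝ))) /
            (2*Complex.I*(tc:ℂ)*(Real.sin θ : ℂ))))) ∧
    (∀ n m : ℕ,
      Tendsto (fun ε : ℝ => green Δ (2*tc) ε n m) (𝓝[>] 0)
        (𝓝 (((|(n:ℝ)-(m:ℝ)| - ((n:ℝ)+(m:ℝ)+2)) / (2*tc) : ℝ) : ℂ))) ∧
    (∀ n m : ℕ,
      Tendsto (fun ε : ℝ => green Δ (-(2*tc)) ε n m) (𝓝[>] 0)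
        (𝓝 ((((-1:ℝ))^(n+m) * (((n:ℝ)+(m:ℝ)+2) - |(n:ℝ)-(m:ℝ)|) / (2*tc) : ℝ) : ℂ))) ∧
    (∀ n m : ℕ, ∃ g : ℝ → ℂ,
      (∀ E : ℝ, Tendsto (fun ε : ℝ => green Δ E ε n m) (𝓝[>] 0) (𝓝 (g E))) ∧
      Continuous g ∧
      (∀ E : ℝ, 2*tc < |E| → (g E).im = 0)) := by
  have hlim := tendsto_green htc hΔsa hΔ
  have htc' : (tc : ℂ) ≠ 0 := by exact_mod_cast htc.ne'
  refine ⟨fun n m θ hθ => ?_, fun n m => ?_, fun n m => ?_, fun n m => ?_⟩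
  · convert hlim (2 * tc * Real.cos θ) n m using 2
    rw [mul_div_cancel_left₀ _ (by positivity), joukowskyInv_cos hθ.1.le hθ.2.le, abs_sub_natCast]
    have hsin : (Real.sin θ : ℂ) ≠ 0 := by
      exact_mod_cast (Real.sin_pos_of_mem_Ioo hθ).ne'
    set w := Complex.exp (-I * θ) with hw
    have hw0 : w ≠ 0 := Complex.exp_ne_zero _
    have e1 : Complex.exp (-I * θ * ((n : ℂ) + m + 2)) = w ^ (n + m + 2) := by
      rw [hw, ← Complex.exp_nat_mul]
      congr 1
      push_cast; ring
    have e2 : Complex.exp (-I * θ * ((((n - m) + (m - n) : ℕ) : ℝ) : ℂ)) =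
        w ^ ((n - m) + (m - n)) := by
      rw [hw, ← Complex.exp_nat_mul]
      congr 1
      push_cast; ring
    have e3 : 2 * I * (Real.sin θ : ℂ) * w = 1 - w ^ 2 := by
      have h1 : Complex.exp (I * θ) * w = 1 := by
        rw [hw, ← Complex.exp_add]; simp
      have h2 : (Real.sin θ : ℂ) = (w - Complex.exp (I * θ)) * I / 2 := by
        rw [Complex.ofReal_sin, Complex.sin, hw]
        ring_nf
      rw [h2]
      linear_combination w * (w - Complex.exp (I * θ)) * I_sq + h1
    rw [e1, e2]
    have hp := one_sub_sq_mul_greenPoly n m w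
    rw [← e3] at hp
    have hp' : 2 * I * (Real.sin θ : ℂ) * greenPoly n m w =
        w ^ ((n - m) + (m - n)) - w ^ (n + m + 2) := by
      apply mul_left_cancel₀ hw0
      linear_combination hp
    rw [div_eq_div_iff (mul_ne_zero (mul_ne_zero (by simp) htc') hsin) htc']
    linear_combination (tc : ℂ) * hp'
  · convert hlim (2 * tc) n m using 2
    have e : |(n : ℝ) - m| - ((n : ℝ) + m + 2) = -(2 * ((min n m : ℕ) + 1 : ℝ)) := by
      rw [two_mul_min_add_one]; ring
    rw [div_self (by positivity), joukowskyInv_one, greenPoly_one, e]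
    generalize min n m = k
    push_cast
    field_simp
  · convert hlim (-(2 * tc)) n m using 2
    rw [neg_div (2 * tc), div_self (by positivity), joukowskyInv_neg_one, greenPoly_neg_one,
      ← two_mul_min_add_one]
    generalize min n m = k
    push_cast
    field_simp
  · refine ⟨fun E => -greenPoly n m (joukowskyInv ((E / (2 * tc) : ℝ) : ℂ)) / tc,
      fun E => hlim E n m, ?_, fun E hE => ?_⟩
    · have h1 := continuous_greenPoly n m
      have h2 := continuous_joukowskyInv
      fun_prop
    · have h1 : 1 ≤ |E / (2 * tc)| := by
        rw [abs_div, abs_of_pos (show 0 < 2 * tc by positivity), one_le_div (by positivity)]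
        exact hE.le
      obtain ⟨x, hx⟩ : ∃ x : ℝ, joukowskyInv ((E / (2 * tc) : ℝ) : ℂ) = x :=
        ⟨_, Complex.ext rfl (by simpa using joukowskyInv_ofReal_im h1)⟩
      simp only [hx, greenPoly]
      norm_cast
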